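/- Let Δ ⊂ ℝⁿ be a nondegenerate simplex with vertices x₀,…,xₙ and f : Δ → ℝ convex. Then Avg(f, Δ) ≤ (1/(n+1))·(f(x₀)+⋯+f(xₙ))/(n+1) + (n/(n+1))·(1/(n+1))·Σ_{K ⊂ N, |K| = n} Avg(f, Δ_K), where the last sum runs over all n-element subsets K of N = {0,…,n} (i.e., all facets of Δ). -/

import Mathlib

open MeasureTheory

/-- The average value of `f` over a set `S` with respect to `d`-dimensional
Hausdorff measure. -/
noncomputable def avgH {n : ℕ} (f : EuclideanSpace ℝ (Fin n) → ℝ) (d : ℝ)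
    (S : Set (EuclideanSpace ℝ (Fin n))) : ℝ :=
  ⨍ y in S, f y ∂(μH[d])

open scoped Pointwise

/-- A convex function which is bounded above on a bounded convex set is integrable there. -/
theorem ConvexOn.integrableOn_of_bddAbove {E : Type*} [NormedAddCommGroup E] [NormedSpace ℝ E]
    [FiniteDimensional ℝ E] [MeasurableSpace E] [BorelSpace E] (μ : Measure E)
    [μ.IsAddHaarMeasure] {S : Set E} {f : E → ℝ} (hf : ConvexOn ℝ S f)
    (hS : Bornology.IsBounded S) (hb : BddAbove (f '' S)) : IntegrableOn f S μ := by
  have hae : interior S =ᵐ[μ] S := interior_ae_eq_of_null_frontier (hf.1.addHaar_frontier μ)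
  refine IntegrableOn.congr_set_ae ?_ hae.symm
  rcases (interior S).eq_empty_or_nonempty with h | ⟨c, hc⟩
  · simp [h]
  obtain ⟨r, hr, hrS⟩ := Metric.isOpen_iff.1 isOpen_interior c hc
  obtain ⟨R, hR, hSR⟩ := hS.subset_closedBall_lt 0 c
  obtain ⟨M, hM⟩ := hb
  replace hM : ∀ y ∈ S, f y ≤ M := fun y hy => hM ⟨y, hy, rfl⟩
  have hε : 0 < r / (2 * R) := by positivity
  set ε := r / (2 * R) with hε_def
  have hlow : ∀ y ∈ S, ((1 + ε) * f c - M) / ε ≤ f y := by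
    intro y hy
    have hz : c + ε • (c - y) ∈ S := by
      refine interior_subset (hrS ?_)
      have h1 : ‖c - y‖ ≤ R := by simpa [dist_eq_norm, norm_sub_rev] using hSR hy
      have h2 : ε * ‖c - y‖ ≤ ε * R := by gcongr
      have h3 : ε * R = r / 2 := by rw [hε_def]; field_simp
      simp only [Metric.mem_ball, dist_eq_norm, add_sub_cancel_left, norm_smul,
        Real.norm_of_nonneg hε.le]
      linarith
    have key := hf.2 hz hy (by positivity : 0 ≤ 1 / (1 + ε)) (by positivity : 0 ≤ ε / (1 + ε))
      (by field_simp)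
    have hcomb : (1 / (1 + ε)) • (c + ε • (c - y)) + (ε / (1 + ε)) • y = c := by
      have h1 : (1 + ε) ≠ 0 := by positivity
      match_scalars
      · field_simp
      · field_simp
        ring
    rw [hcomb] at key
    simp only [smul_eq_mul] at key
    have h4 := hM _ hz
    have h5 : (1 + ε) * f c ≤ f (c + ε • (c - y)) + ε * f y := by
      have := mul_le_mul_of_nonneg_left key (by positivity : 0 ≤ 1 + ε)
      refine this.trans (le_of_eq ?_)
      field_simp
    rw [div_le_iff₀ hε]
    linarith
  refine IntegrableOn.of_bound
    ((hS.subset interior_subset).measure_lt_top)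
    (hf.continuousOn_interior.aestronglyMeasurable isOpen_interior.measurableSet)
    (max |((1 + ε) * f c - M) / ε| |M|) ?_
  refine (ae_restrict_mem isOpen_interior.measurableSet).mono fun y hy => ?_
  exact abs_le_max_abs_abs (hlow y (interior_subset hy)) (hM y (interior_subset hy))

/-- Integrating a convex function over the cone with apex `0` and base `{1} × F` slice by slice. -/
theorem ConvexOn.setIntegral_cone_le {V : Type*} [NormedAddCommGroup V] [NormedSpace ℝ V]
    [FiniteDimensional ℝ V] [MeasurableSpace V] [BorelSpace V] (μ : Measure V)
    [μ.IsAddHaarMeasure] {F : Set V} (hF : IsCompact F) {C : Set (ℝ × V)} (hC : IsCompact C)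
    (hCF : ∀ t v, (t, v) ∈ C ↔ t ∈ Set.Icc (0 : ℝ) 1 ∧ ∃ u ∈ F, v = t • u)
    {g : ℝ × V → ℝ} (hg : ConvexOn ℝ C g) (hb : BddAbove (g '' C)) :
    ∫ z in C, g z ∂((volume : Measure ℝ).prod μ) ≤
      μ.real F * g 0 / ((Module.finrank ℝ V + 1) * (Module.finrank ℝ V + 2)) +
        (∫ v in F, g (1, v) ∂μ) / (Module.finrank ℝ V + 2) := by
  set m := Module.finrank ℝ V with hm
  have hbF : ∀ t ∈ Set.Icc (0 : ℝ) 1, ∀ v ∈ F, (t, t • v) ∈ C :=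
    fun t ht v hv => (hCF _ _).2 ⟨ht, v, hv, rfl⟩
  have hFconv : Convex ℝ F := by
    intro u hu v hv a b ha hb hab
    have h := hg.1 (hbF 1 (by simp) u hu) (hbF 1 (by simp) v hv) ha hb hab
    simp only [one_smul, Prod.smul_mk, smul_eq_mul, mul_one, Prod.mk_add_mk, hab] at h
    obtain ⟨-, w, hw, hw'⟩ := (hCF _ _).1 h
    rw [hw', one_smul]
    exact hw
  have hslice_int : ∀ t ∈ Set.Icc (0 : ℝ) 1, IntegrableOn (fun v => g (t, t • v)) F μ := by
    intro t ht
    refine ConvexOn.integrableOn_of_bddAbove μ ⟨hFconv, ?_⟩ hF.isBounded ?_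
    · intro u hu v hv a b ha hb hab
      have h := hg.2 (hbF t ht u hu) (hbF t ht v hv) ha hb hab
      convert h using 2
      ext
      · simp [← add_mul, hab]
      · simp [smul_comm t]
    · refine hb.mono ?_
      rintro _ ⟨v, hv, rfl⟩
      exact ⟨_, hbF t ht v hv, rfl⟩
  have hF1 : IntegrableOn (fun v => g (1, v)) F μ := by
    simpa using hslice_int 1 (by simp)
  have hgint : IntegrableOn g C ((volume : Measure ℝ).prod μ) :=
    hg.integrableOn_of_bddAbove _ hC.isBounded hb
  have hind : Integrable (C.indicator g) ((volume : Measure ℝ).prod μ) :=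
    (integrable_indicator_iff hC.measurableSet).2 hgint
  rw [← integral_indicator hC.measurableSet, integral_prod _ hind]
  have hzero : ∀ t ∉ Set.Icc (0 : ℝ) 1, ∫ v, C.indicator g (t, v) ∂μ = 0 := by
    intro t ht
    refine integral_eq_zero_of_ae (ae_of_all _ fun v => ?_)
    exact Set.indicator_of_notMem (fun h => ht ((hCF _ _).1 h).1) _
  rw [← setIntegral_eq_integral_of_forall_compl_eq_zero hzero]
  set A := μ.real F * g 0
  set B := ∫ v in F, g (1, v) ∂μ
  have hslice : ∀ t ∈ Set.Ioc (0 : ℝ) 1, ∫ v, C.indicator g (t, v) ∂μ ≤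
      (t ^ m - t ^ (m + 1)) * A + t ^ (m + 1) * B := by
    intro t ht
    have ht' : t ∈ Set.Icc (0 : ℝ) 1 := ⟨ht.1.le, ht.2⟩
    have h1 : ∀ v, C.indicator g (t, v) = (t • F).indicator (fun v => g (t, v)) v := by
      intro v
      have : (t, v) ∈ C ↔ v ∈ t • F := by
        rw [hCF, Set.mem_smul_set]
        simp only [ht', true_and, eq_comm]
      by_cases hv : v ∈ t • F
      · rw [Set.indicator_of_mem hv, Set.indicator_of_mem (this.2 hv)]
      · rw [Set.indicator_of_notMem hv, Set.indicator_of_notMem (mt this.1 hv)]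
    simp_rw [h1]
    rw [integral_indicator (hF.smul t).measurableSet]
    have h2 := Measure.setIntegral_comp_smul_of_pos μ (fun v => g (t, v)) F ht.1
    rw [← hm, smul_eq_mul, eq_inv_mul_iff_mul_eq₀ (pow_pos ht.1 m).ne'] at h2
    rw [← h2]
    have hconst : IntegrableOn (fun _ : V => (1 - t) * g 0) F μ :=
      integrableOn_const hF.measure_lt_top.ne
    have h3 : ∫ v in F, g (t, t • v) ∂μ ≤ ∫ v in F, ((1 - t) * g 0 + t * g (1, v)) ∂μ := by
      refine setIntegral_mono_on (hslice_int t ht') ?_ hF.measurableSet ?_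
      · exact hconst.add (hF1.const_mul t)
      · intro v hv
        have h := hg.2 (hbF 0 (by simp) v hv) (hbF 1 (by simp) v hv) (sub_nonneg.2 ht.2) ht.1.le
          (by ring)
        simpa [← Prod.zero_eq_mk] using h
    rw [integral_add hconst (hF1.const_mul t),
      setIntegral_const, integral_const_mul] at h3
    refine (mul_le_mul_of_nonneg_left h3 (pow_nonneg ht.1.le m)).trans (le_of_eq ?_)
    simp only [smul_eq_mul, A, B]
    ring
  rw [integral_Icc_eq_integral_Ioc]
  have hcont : Continuous fun t : ℝ => (t ^ m - t ^ (m + 1)) * A + t ^ (m + 1) * B := by fun_prop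
  refine (setIntegral_mono_on hind.integral_prod_left.integrableOn
    (hcont.integrableOn_Ioc) measurableSet_Ioc hslice).trans (le_of_eq ?_)
  rw [← intervalIntegral.integral_of_le zero_le_one, intervalIntegral.integral_add,
    intervalIntegral.integral_mul_const, intervalIntegral.integral_mul_const,
    intervalIntegral.integral_sub, integral_pow, integral_pow]
  · push_cast
    simp
    field_simp
    ring
  all_goals exact Continuous.intervalIntegrable (by fun_prop) _ _

/-- The average of a convex function over a cone is at most a combination of its value at the apex
and its average over the base. -/
theorem ConvexOn.setAverage_cone_le {V : Type*} [NormedAddCommGroup V] [NormedSpace ℝ V]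
    [FiniteDimensional ℝ V] [MeasurableSpace V] [BorelSpace V] (μ : Measure V)
    [μ.IsAddHaarMeasure] {F : Set V} (hF : IsCompact F) {C : Set (ℝ × V)} (hC : IsCompact C)
    (hCF : ∀ t v, (t, v) ∈ C ↔ t ∈ Set.Icc (0 : ℝ) 1 ∧ ∃ u ∈ F, v = t • u)
    {g : ℝ × V → ℝ} (hg : ConvexOn ℝ C g) (hb : BddAbove (g '' C))
    (hpos : ((volume : Measure ℝ).prod μ) C ≠ 0) :
    ⨍ z in C, g z ∂((volume : Measure ℝ).prod μ) ≤
      1 / (Module.finrank ℝ V + 2) * g 0 +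
        (Module.finrank ℝ V + 1) / (Module.finrank ℝ V + 2) * ⨍ v in F, g (1, v) ∂μ := by
  have hvol : ((volume : Measure ℝ).prod μ).real C = μ.real F / (Module.finrank ℝ V + 1) := by
    have hbdd : ∀ c : ℝ, BddAbove ((fun _ : ℝ × V => c) '' C) := fun c =>
      ⟨c, by rintro _ ⟨_, _, rfl⟩; exact le_rfl⟩
    have h1 := (convexOn_const (1 : ℝ) hg.1).setIntegral_cone_le μ hF hC hCF (hbdd 1)
    have h2 := (convexOn_const (-1 : ℝ) hg.1).setIntegral_cone_le μ hF hC hCF (hbdd (-1))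
    simp only [setIntegral_const, smul_eq_mul, mul_one, mul_neg] at h1 h2
    have h3 : μ.real F / ((Module.finrank ℝ V + 1) * (Module.finrank ℝ V + 2)) +
        μ.real F / (Module.finrank ℝ V + 2) = μ.real F / ((Module.finrank ℝ V : ℝ) + 1) := by
      field_simp
      ring
    simp only [neg_div] at h2
    linarith
  have hCpos : 0 < ((volume : Measure ℝ).prod μ).real C :=
    ENNReal.toReal_pos hpos hC.measure_lt_top.ne
  have hFpos : 0 < μ.real F := by
    rw [hvol] at hCpos
    by_contra h
    exact absurd hCpos (not_lt.2 (div_nonpos_of_nonpos_of_nonneg (not_lt.1 h) (by positivity)))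
  rw [setAverage_eq, setAverage_eq, smul_eq_mul, smul_eq_mul, inv_mul_le_iff₀ hCpos, hvol]
  refine (hg.setIntegral_cone_le μ hF hC hCF hb).trans (le_of_eq ?_)
  field_simp

theorem MeasurableEmbedding.setAverage_map {X Y : Type*} [MeasurableSpace X] [MeasurableSpace Y]
    {μ : Measure X} {e : X → Y} (he : MeasurableEmbedding e) (f : Y → ℝ) (s : Set Y) :
    ⨍ y in s, f y ∂(μ.map e) = ⨍ x in e ⁻¹' s, f (e x) ∂μ := by
  rw [setAverage_eq, setAverage_eq, he.setIntegral_map, Measure.real, Measure.real, he.map_apply]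

theorem setAverage_smul_measure {X : Type*} [MeasurableSpace X] {μ : Measure X} {c : NNReal}
    (hc : c ≠ 0) (f : X → ℝ) (s : Set X) :
    ⨍ x in s, f x ∂(c • μ) = ⨍ x in s, f x ∂μ := by
  rw [setAverage_eq, setAverage_eq, Measure.restrict_smul, integral_smul_nnreal_measure,
    measureReal_nnreal_smul_apply]
  have : (c : ℝ) ≠ 0 := by exact_mod_cast hc
  simp only [NNReal.smul_def, smul_eq_mul]
  field_simp

/-- The average over a simplex is at most a combination of the value at a vertex and the average
over the opposite facet. -/
theorem avgH_simplex_le_vertex_facet (m : ℕ)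
    (x : Fin (m + 1 + 1) → EuclideanSpace ℝ (Fin (m + 1)))
    (hx : AffineIndependent ℝ x) (f : EuclideanSpace ℝ (Fin (m + 1)) → ℝ)
    (hf : ConvexOn ℝ (convexHull ℝ (Set.range x)) f) (i : Fin (m + 1 + 1)) :
    avgH f ((m + 1 : ℕ) : ℝ) (convexHull ℝ (Set.range x)) ≤
      1 / ((m : ℝ) + 2) * f (x i) + ((m : ℝ) + 1) / (m + 2) *
        avgH f m (convexHull ℝ (Set.range (x ∘ i.succAbove))) := by
  set Δ := convexHull ℝ (Set.range x)
  set Φ := convexHull ℝ (Set.range (x ∘ i.succAbove))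
  have hy : AffineIndependent ℝ (x ∘ i.succAbove) := hx.comp_embedding i.succAboveEmb
  set V := vectorSpan ℝ (Set.range (x ∘ i.succAbove))
  have hVdim : Module.finrank ℝ V = m := hy.finrank_vectorSpan (by simp)
  set p := x (i.succAbove 0)
  have hp : p ∈ Set.range (x ∘ i.succAbove) := ⟨0, rfl⟩
  have hΦspan : Φ ⊆ affineSpan ℝ (Set.range (x ∘ i.succAbove)) := convexHull_subset_affineSpan _
  have hpspan : p ∈ affineSpan ℝ (Set.range (x ∘ i.succAbove)) := subset_affineSpan ℝ _ hp
  have hpV : p - x i ∉ V := by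
    intro h
    have h1 : x i ∈ affineSpan ℝ (Set.range (x ∘ i.succAbove)) := by
      have := AffineSubspace.vadd_mem_of_mem_direction
        (by rw [direction_affineSpan]; exact V.neg_mem h) hpspan
      simpa using this
    refine hx.notMem_affineSpan_sdiff i Set.univ ?_
    rw [Set.range_comp, Fin.range_succAbove] at h1
    rwa [← Set.compl_eq_univ_sdiff]
  have hΦV : ∀ z ∈ Φ, z - p ∈ V := by
    intro z hz
    have := AffineSubspace.vsub_mem_direction (hΦspan hz) hpspan
    rwa [direction_affineSpan] at this
  let l : ℝ × V →ₗ[ℝ] EuclideanSpace ℝ (Fin (m + 1)) :=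
    (LinearMap.toSpanSingleton ℝ _ (p - x i)).coprod V.subtype
  have hl : ∀ t v, l (t, v) = t • (p - x i) + (v : EuclideanSpace ℝ (Fin (m + 1))) := fun t v => by
    simp [l]
  have hlinj : Function.Injective l := by
    rw [injective_iff_map_eq_zero]
    rintro ⟨t, v⟩ h
    rw [hl] at h
    have ht : t = 0 := by
      by_contra ht
      refine hpV ?_
      have h1 : p - x i = -(t⁻¹ • (v : EuclideanSpace ℝ (Fin (m + 1)))) := by
        rw [← smul_neg, eq_inv_smul_iff₀ ht, eq_neg_iff_add_eq_zero, h]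
      rw [h1]
      exact V.neg_mem (V.smul_mem _ v.2)
    subst ht
    simpa using h
  let L : (ℝ × V) ≃L[ℝ] EuclideanSpace ℝ (Fin (m + 1)) :=
    (l.linearEquivOfInjective hlinj (by simp [hVdim, add_comm])).toContinuousLinearEquiv
  have hL : ∀ t v, L (t, v) = t • (p - x i) + (v : EuclideanSpace ℝ (Fin (m + 1))) := hl
  have hiso : Isometry (fun v : V => (v : EuclideanSpace ℝ (Fin (m + 1))) + p) :=
    (IsometryEquiv.addRight p).isometry.comp isometry_subtype_coe
  set F := (fun v : V => (v : EuclideanSpace ℝ (Fin (m + 1))) + p) ⁻¹' Φ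
  have hfacet : avgH f m Φ = ⨍ v in F, f (v + p) ∂(μH[(m : ℝ)]) := by
    rw [← hiso.isClosedEmbedding.measurableEmbedding.setAverage_map,
      hiso.map_hausdorffMeasure (Or.inl (Nat.cast_nonneg m)), avgH,
      Measure.restrict_restrict_of_subset]
    intro z hz
    exact ⟨⟨z - p, hΦV z hz⟩, by simp⟩
  have hF : IsCompact F := hiso.isClosedEmbedding.isCompact_preimage
    ((Set.finite_range _).isCompact_convexHull ℝ)
  have : (μH[(m : ℝ)] : Measure V).IsAddHaarMeasure := by
    have := isAddHaarMeasure_hausdorffMeasure (E := V)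
    rwa [hVdim] at this
  let Ψ : (ℝ × V) ≃ₜ EuclideanSpace ℝ (Fin (m + 1)) :=
    L.toHomeomorph.trans (Homeomorph.addLeft (x i))
  have hΨ : ∀ t v, Ψ (t, v) = x i + (t • (p - x i) + v) := fun t v => by
    rw [← hL]; rfl
  have hmap : (Measure.map L.symm μH[((m + 1 : ℕ) : ℝ)]).map Ψ = μH[((m + 1 : ℕ) : ℝ)] := by
    rw [Measure.map_map Ψ.continuous.measurable L.symm.continuous.measurable]
    have : Ψ ∘ L.symm = fun z => x i + z := by
      ext1 z
      change x i + L (L.symm z) = _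
      simp
    rw [this]
    exact map_add_left_eq_self _ _
  have hsimplex : avgH f ((m + 1 : ℕ) : ℝ) Δ =
      ⨍ z in Ψ ⁻¹' Δ, f (Ψ z) ∂((volume : Measure ℝ).prod (μH[(m : ℝ)] : Measure V)) := by
    rw [avgH, ← hmap, Ψ.isClosedEmbedding.measurableEmbedding.setAverage_map,
      Measure.isAddLeftInvariant_eq_smul (Measure.map L.symm μH[((m + 1 : ℕ) : ℝ)])
        ((volume : Measure ℝ).prod (μH[(m : ℝ)] : Measure V)),
      setAverage_smul_measure (Measure.addHaarScalarFactor_pos_of_isAddHaarMeasure _ _).ne']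
  have hC : IsCompact (Ψ ⁻¹' Δ) :=
    Ψ.isCompact_preimage.2 ((Set.finite_range _).isCompact_convexHull ℝ)
  have hΔ : Δ = convexJoin ℝ {x i} Φ := by
    rw [← convexHull_insert (Set.range_nonempty _)]
    rw [Set.range_comp, Fin.range_succAbove, ← Set.image_insert_eq, Set.insert_eq,
      Set.union_compl_self, Set.image_univ]
  have hCF : ∀ t v, (t, v) ∈ Ψ ⁻¹' Δ ↔ t ∈ Set.Icc (0 : ℝ) 1 ∧ ∃ u ∈ F, v = t • u := by
    intro t v
    have hcomb : ∀ (s : ℝ) (u : V), Ψ (s, s • u) = (1 - s) • x i + s • ((u : _) + p) := by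
      intro s u
      rw [hΨ, Submodule.coe_smul]
      module
    rw [Set.mem_preimage, hΔ, convexJoin_singleton_left]
    simp only [Set.mem_iUnion, segment_eq_image, Set.mem_image, exists_prop]
    constructor
    · rintro ⟨z, hz, s, hs, h⟩
      have hu : Ψ (s, s • ⟨z - p, hΦV z hz⟩) = Ψ (t, v) := by
        rw [hcomb, ← h]
        simp
      obtain ⟨rfl, rfl⟩ := Prod.mk.inj (Ψ.injective hu)
      exact ⟨hs, ⟨z - p, hΦV z hz⟩, by simpa [F] using hz, rfl⟩
    · rintro ⟨ht, u, hu, rfl⟩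
      exact ⟨_, hu, t, ht, (hcomb t u).symm⟩
  have hconv : ConvexOn ℝ (Ψ ⁻¹' Δ) (fun z => f (Ψ z)) :=
    hf.comp_affineMap (AffineMap.const ℝ _ (x i) + (L : (ℝ × V) →ₗ[ℝ] _).toAffineMap)
  have hbdd : BddAbove ((fun z => f (Ψ z)) '' (Ψ ⁻¹' Δ)) := by
    have hΔb : BddAbove (f '' Δ) := hf.bddAbove_convexHull (subset_convexHull ℝ _)
      ((Set.finite_range x).image f).bddAbove
    refine hΔb.mono ?_
    rintro _ ⟨z, hz, rfl⟩
    exact ⟨_, hz, rfl⟩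
  have hpos : ((volume : Measure ℝ).prod (μH[(m : ℝ)] : Measure V)) (Ψ ⁻¹' Δ) ≠ 0 := by
    refine (Measure.measure_pos_of_nonempty_interior _ ?_).ne'
    rw [← Ψ.preimage_interior]
    refine Set.Nonempty.preimage ?_ Ψ.surjective
    rw [interior_convexHull_nonempty_iff_affineSpan_eq_top,
      hx.affineSpan_eq_top_iff_card_eq_finrank_add_one]
    simp
  have key := hconv.setAverage_cone_le _ hF hC hCF hbdd hpos
  have h0 : Ψ 0 = x i := by
    rw [Prod.zero_eq_mk, hΨ]
    simp
  have h1 : ∀ v : V, Ψ (1, v) = v + p := fun v => by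
    rw [hΨ]
    module
  rw [hsimplex, hfacet]
  simpa only [hVdim, h0, h1] using key

theorem avg_le_vertices_facets (n : ℕ) (x : Fin (n + 1) → EuclideanSpace ℝ (Fin n))
    (hx : AffineIndependent ℝ x) (f : EuclideanSpace ℝ (Fin n) → ℝ)
    (hf : ConvexOn ℝ (convexHull ℝ (Set.range x)) f) :
    avgH f (n : ℝ) (convexHull ℝ (Set.range x)) ≤
      (1 / ((n : ℝ) + 1)) * ((∑ i, f (x i)) / ((n : ℝ) + 1)) +
        ((n : ℝ) / ((n : ℝ) + 1)) * (1 / ((n : ℝ) + 1)) *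
          ∑ K ∈ Finset.powersetCard n (Finset.univ : Finset (Fin (n + 1))),
            avgH f ((n : ℝ) - 1) (convexHull ℝ (x '' ↑K)) := by
  rcases n with _ | m
  · have : Set.range x = {x 0} := by
      ext y
      simp [Fin.exists_fin_one, eq_comm]
    rw [this, convexHull_singleton, avgH, setAverage_eq]
    simp [Measure.real]
  have hfacets : ∑ K ∈ Finset.powersetCard (m + 1) (Finset.univ : Finset (Fin (m + 1 + 1))),
      avgH f (((m + 1 : ℕ) : ℝ) - 1) (convexHull ℝ (x '' ↑K)) =
      ∑ i : Fin (m + 1 + 1), avgH f m (convexHull ℝ (Set.range (x ∘ i.succAbove))) := by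
    symm
    refine Finset.sum_bij (fun i _ => {i}ᶜ) ?_ ?_ ?_ ?_
    · intro i _
      simp [Finset.mem_powersetCard, Finset.card_compl]
    · intro i _ j _ h
      simpa using h
    · intro K hK
      have hK' : Kᶜ.card = 1 := by
        rw [Finset.card_compl, (Finset.mem_powersetCard.1 hK).2]
        simp
      obtain ⟨i, hi⟩ := Finset.card_eq_one.1 hK'
      exact ⟨i, Finset.mem_univ _, by rw [← hi, compl_compl]⟩
    · intro i _
      rw [Set.range_comp, Fin.range_succAbove]
      simp
  rw [hfacets]
  have hsum := Finset.sum_le_sum fun i (_ : i ∈ Finset.univ) =>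
    avgH_simplex_le_vertex_facet m x hx f hf i
  rw [Finset.sum_add_distrib, ← Finset.mul_sum, ← Finset.mul_sum, Finset.sum_const,
    Finset.card_univ, Fintype.card_fin, nsmul_eq_mul, mul_comm,
    ← le_div_iff₀ (by positivity)] at hsum
  refine hsum.trans (le_of_eq ?_)
  push_cast
  have h2 : (m : ℝ) + 1 + 1 = m + 2 := by ring
  rw [h2]
  field_simp
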